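/- Let α, β, γ ∈ ℂ with α + β + γ = 0, γ ≠ 0, let m be a positive integer, let a₄, a₅, a₆, a₈, a₉, a₁₀, C ∈ ℂ with 2a₄a₇ − a₈a₁₀ ≠ 0, a₆ ≠ 0, 2a₄a₉ − a₆a₈ ≠ 0, a₆a₁₀ − 2a₄a₅ ≠ 0, and define a₇ = −(αa₅a₈ + βa₉a₁₀)/(γa₆), a₁ = [a₆(αa₉a₁₀ + βa₅a₈) + 2γa₄a₅a₉]/[2γ(2a₄a₇ − a₈a₁₀)], a₂ = [αa₁₀(a₅a₈ − a₉a₁₀) + γa₅(2a₄a₇ − a₈a₁₀)]/[2γ(2a₄a₉ − a₆a₈)], a₃ = [βa₈(a₅a₈ − a₉a₁₀) − γa₉(2a₄a₇ − a₈a₁₀)]/[2γ(a₆a₁₀ − 2a₄a₅)]. Define Q(z) = a₁(z¹)^{2m} + a₂(z²)^{2m} + a₃(z³)^{2m} + a₄(z⁴)^{2m} + a₅(z¹)^m(z²)^m + a₆(z¹)^m(z⁴)^m + a₇(z²)^m(z³)^m + a₈(z³)^m(z⁴)^m + a₉(z¹)^m(z³)^m + a₁₀(z²)^m(z⁴)^m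 + C. If u : U → ℂ is twice continuously differentiable on an open set U ⊆ ℂ⁴, u(z) ≠ 0 on U, and u(z)^{2m} = Q(z) for all z ∈ U, then u satisfies the general heavenly equation α u_{12}u_{34} + β u_{13}u_{24} + γ u_{14}u_{23} = 0 on U. -/

import Mathlib

/-!  Coordinates: `z : Fin 4 → ℂ` with paper indices `z¹,z²,z³,z⁴` corresponding to
`z 0, z 1, z 2, z 3`.  `pd i f` is the partial derivative ∂f/∂zⁱ. -/

/-- Partial derivative of `f : ℂ⁴ → ℂ` in the `i`-th coordinate direction. -/
noncomputable def pd (i : Fin 4) (f : (Fin 4 → ℂ) → ℂ) : (Fin 4 → ℂ) → ℂ :=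
  fun z => fderiv ℂ f z (Pi.single i 1)

/-- The polynomial `Q(z) = a₁(z¹)^{2m} + a₂(z²)^{2m} + a₃(z³)^{2m} + a₄(z⁴)^{2m}
+ a₅(z¹)^m(z²)^m + a₆(z¹)^m(z⁴)^m + a₇(z²)^m(z³)^m + a₈(z³)^m(z⁴)^m
+ a₉(z¹)^m(z³)^m + a₁₀(z²)^m(z⁴)^m + C`. -/
noncomputable def Qpoly (m : ℕ) (a1 a2 a3 a4 a5 a6 a7 a8 a9 a10 C : ℂ)
    (z : Fin 4 → ℂ) : ℂ :=
  a1 * (z 0) ^ (2 * m) + a2 * (z 1) ^ (2 * m) + a3 * (z 2) ^ (2 * m) + a4 * (z 3) ^ (2 * m)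
    + a5 * (z 0) ^ m * (z 1) ^ m + a6 * (z 0) ^ m * (z 3) ^ m
    + a7 * (z 1) ^ m * (z 2) ^ m + a8 * (z 2) ^ m * (z 3) ^ m
    + a9 * (z 0) ^ m * (z 2) ^ m + a10 * (z 1) ^ m * (z 3) ^ m + C

lemma E1_id
    (α β γ : ℂ) (hαβγ : α + β + γ = 0) (hγ : γ ≠ 0)
    (a1 a2 a3 a4 a5 a6 a7 a8 a9 a10 : ℂ)
    (ha6 : a6 ≠ 0)
    (ha7 : a7 = -(α * a5 * a8 + β * a9 * a10) / (γ * a6))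
    (hd1 : 2 * a4 * a7 - a8 * a10 ≠ 0)
    (hd2 : 2 * a4 * a9 - a6 * a8 ≠ 0)
    (hd3 : a6 * a10 - 2 * a4 * a5 ≠ 0)
    (ha1 : a1 = (a6 * (α * a9 * a10 + β * a5 * a8) + 2 * γ * a4 * a5 * a9)
      / (2 * γ * (2 * a4 * a7 - a8 * a10)))
    (ha2 : a2 = (α * a10 * (a5 * a8 - a9 * a10) + γ * a5 * (2 * a4 * a7 - a8 * a10))
      / (2 * γ * (2 * a4 * a9 - a6 * a8)))
    (ha3 : a3 = (β * a8 * (a5 * a8 - a9 * a10) - γ * a9 * (2 * a4 * a7 - a8 * a10))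
      / (2 * γ * (a6 * a10 - 2 * a4 * a5)))
    (x0 x1 x2 x3 l0 l1 l2 l3 : ℂ)
    (h0 : l0 = 2 * a1 * x0 + a5 * x1 + a9 * x2 + a6 * x3)
    (h1 : l1 = a5 * x0 + 2 * a2 * x1 + a7 * x2 + a10 * x3)
    (h2 : l2 = a9 * x0 + a7 * x1 + 2 * a3 * x2 + a8 * x3)
    (h3 : l3 = a6 * x0 + a10 * x1 + a8 * x2 + 2 * a4 * x3) :
    α * (a5 * l2 * l3 + a8 * l0 * l1) + β * (a9 * l1 * l3 + a10 * l0 * l2)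
      + γ * (a6 * l1 * l2 + a7 * l0 * l3) = 0 := by
  have hβ : β = -α - γ := by linear_combination hαβγ
  obtain ⟨D, hD⟩ : ∃ D, D = 2 * a4 * -(α * a5 * a8 + β * a9 * a10) - γ * a6 * a8 * a10 := ⟨_, rfl⟩
  have hDe : 2 * a4 * a7 - a8 * a10 = D / (γ * a6) := by
    rw [ha7, hD]; field_simp
  have hD0 : D ≠ 0 := by
    rintro rfl; simp [hDe] at hd1
  rw [hDe] at ha1 ha2 ha3
  have hk : ∀ d : ℂ, d ≠ 0 → d * (α * (a5 * l2 * l3 + a8 * l0 * l1) + β * (a9 * l1 * l3 + a10 * l0 * l2)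
      + γ * (a6 * l1 * l2 + a7 * l0 * l3)) = 0 → α * (a5 * l2 * l3 + a8 * l0 * l1) + β * (a9 * l1 * l3 + a10 * l0 * l2)
      + γ * (a6 * l1 * l2 + a7 * l0 * l3) = 0 := fun d hd h => (mul_eq_zero.mp h).resolve_left hd
  obtain ⟨d2, hd2e⟩ : ∃ D, D = 2 * a4 * a9 - a6 * a8 := ⟨_, rfl⟩
  obtain ⟨d3, hd3e⟩ : ∃ D, D = a6 * a10 - 2 * a4 * a5 := ⟨_, rfl⟩
  rw [← hd2e] at hd2 ha2
  rw [← hd3e] at hd3 ha3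
  rw [h0, h1, h2, h3, ha1, ha2, ha3, ha7]
  clear hk hDe hd1 h0 h1 h2 h3 ha1 ha2 ha3 ha7
  field_simp
  subst hD hd2e hd3e hβ
  ring

lemma pd_eq {f : (Fin 4 → ℂ) → ℂ} {f' : (Fin 4 → ℂ) →L[ℂ] ℂ} {z : Fin 4 → ℂ}
    (h : HasFDerivAt f f' z) (i : Fin 4) : pd i f z = f' (Pi.single i 1) := by
  simp [pd, h.fderiv]

lemma pd_congr {f g : (Fin 4 → ℂ) → ℂ} {U : Set (Fin 4 → ℂ)} (hU : IsOpen U)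
    (h : ∀ z ∈ U, f z = g z) (i : Fin 4) (z) (hz : z ∈ U) : pd i f z = pd i g z := by
  have : f =ᶠ[nhds z] g := Filter.eventuallyEq_of_mem (hU.mem_nhds hz) h
  simp [pd, this.fderiv_eq]

lemma hx (m : ℕ) (k : Fin 4) (z : Fin 4 → ℂ) :
    HasFDerivAt (fun z : Fin 4 → ℂ => z k ^ m)
      ((m * z k ^ (m - 1)) • (ContinuousLinearMap.proj k : (Fin 4 → ℂ) →L[ℂ] ℂ)) z := by
  have := (ContinuousLinearMap.proj (R := ℂ) (φ := fun _ : Fin 4 => ℂ) k).hasFDerivAt (x := z) |>.pow m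
  simpa using this

/-- linear form in the powers -/
noncomputable def lf (m : ℕ) (c : Fin 4 → ℂ) (z : Fin 4 → ℂ) : ℂ :=
  c 0 * z 0 ^ m + c 1 * z 1 ^ m + c 2 * z 2 ^ m + c 3 * z 3 ^ m

lemma pd_lf (m : ℕ) (c : Fin 4 → ℂ) (i j : Fin 4) (hij : i ≠ j) (z : Fin 4 → ℂ) :
    pd j (fun z => m * z i ^ (m - 1) * lf m c z) z
      = m ^ 2 * z i ^ (m - 1) * z j ^ (m - 1) * c j := by
  have h := ((hx (m-1) i z).const_mul (m : ℂ)).mul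
    (((((hx m 0 z).const_mul (c 0)).add ((hx m 1 z).const_mul (c 1))).add
      ((hx m 2 z).const_mul (c 2))).add ((hx m 3 z).const_mul (c 3)))
  refine (pd_eq h j).trans ?_
  fin_cases i <;> fin_cases j <;> simp at hij ⊢ <;> ring

lemma pd_Q (m : ℕ) (a1 a2 a3 a4 a5 a6 a7 a8 a9 a10 C : ℂ) (z : Fin 4 → ℂ) (i : Fin 4) :
    pd i (Qpoly m a1 a2 a3 a4 a5 a6 a7 a8 a9 a10 C) z
      = m * z i ^ (m - 1) * lf m ((![![2 * a1, a5, a9, a6], ![a5, 2 * a2, a7, a10],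
          ![a9, a7, 2 * a3, a8], ![a6, a10, a8, 2 * a4]] : Fin 4 → Fin 4 → ℂ) i) z := by
  have hs := fun (c : ℂ) (k : Fin 4) => ((hx m k z).mul (hx m k z)).const_mul c
  have hp := fun (c : ℂ) (k l : Fin 4) => ((hx m k z).const_mul c).mul (hx m l z)
  have h := ((((((((((hs a1 0).add (hs a2 1)).add (hs a3 2)).add (hs a4 3)).add (hp a5 0 1)).add
    (hp a6 0 3)).add (hp a7 1 2)).add (hp a8 2 3)).add (hp a9 0 2)).add (hp a10 1 3)).add_const C
  refine (pd_eq (h.congr_of_eventuallyEq (Filter.Eventually.of_forall fun y => ?_)) i).trans ?_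
  · simp [Qpoly, two_mul, pow_add]
  · fin_cases i <;> simp [lf] <;> ring

lemma pd_u {n : ℕ} {u Q : (Fin 4 → ℂ) → ℂ} {U : Set (Fin 4 → ℂ)} (hU : IsOpen U)
    (hu : ContDiffOn ℂ 2 u U) (h : ∀ z ∈ U, u z ^ n = Q z) (i : Fin 4) (z) (hz : z ∈ U) :
    n * u z ^ (n - 1) * pd i u z = pd i Q z := by
  rw [← pd_congr hU h i z hz]
  have hd : DifferentiableAt ℂ u z :=
    (hu.differentiableOn (by norm_num)).differentiableAt (hU.mem_nhds hz)
  rw [pd_eq (hd.hasFDerivAt.pow n) i]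
  simp [pd]

lemma pd_pd_u {n : ℕ} {u Q : (Fin 4 → ℂ) → ℂ} {U : Set (Fin 4 → ℂ)} (hU : IsOpen U)
    (hu : ContDiffOn ℂ 2 u U) (h : ∀ z ∈ U, u z ^ n = Q z) (i j : Fin 4) (z) (hz : z ∈ U) :
    n * (n - 1 : ℕ) * u z ^ (n - 1 - 1) * pd j u z * pd i u z
      + n * u z ^ (n - 1) * pd j (pd i u) z = pd j (pd i Q) z := by
  rw [← pd_congr hU (pd_u hU hu h i) j z hz]
  have hd : DifferentiableAt ℂ u z :=
    (hu.differentiableOn (by norm_num)).differentiableAt (hU.mem_nhds hz)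
  have hd2 : DifferentiableAt ℂ (pd i u) z := by
    have h1 : ContDiffAt ℂ 2 u z := hu.contDiffAt (hU.mem_nhds hz)
    have h2 : DifferentiableAt ℂ (fderiv ℂ u) z :=
      (h1.fderiv_right (m := 1) (by norm_num)).differentiableAt (by norm_num)
    exact h2.clm_apply (differentiableAt_const _)
  refine Eq.trans ?_ (pd_eq (((hd.hasFDerivAt.pow (n-1)).const_mul (n : ℂ)).mul hd2.hasFDerivAt) j).symm
  simp [pd]
  ring

/-- the first family (\ref{sol1}) of coefficients yields algebraic solutions
`u^{2m} = Q(z)` of the general heavenly equation. -/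
theorem algebraic_solution_family_one
    (α β γ : ℂ) (hαβγ : α + β + γ = 0) (hγ : γ ≠ 0)
    (m : ℕ) (hm : 0 < m)
    (a1 a2 a3 a4 a5 a6 a7 a8 a9 a10 C : ℂ)
    (ha6 : a6 ≠ 0)
    (ha7 : a7 = -(α * a5 * a8 + β * a9 * a10) / (γ * a6))
    (hd1 : 2 * a4 * a7 - a8 * a10 ≠ 0)
    (hd2 : 2 * a4 * a9 - a6 * a8 ≠ 0)
    (hd3 : a6 * a10 - 2 * a4 * a5 ≠ 0)
    (ha1 : a1 = (a6 * (α * a9 * a10 + β * a5 * a8) + 2 * γ * a4 * a5 * a9)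
      / (2 * γ * (2 * a4 * a7 - a8 * a10)))
    (ha2 : a2 = (α * a10 * (a5 * a8 - a9 * a10) + γ * a5 * (2 * a4 * a7 - a8 * a10))
      / (2 * γ * (2 * a4 * a9 - a6 * a8)))
    (ha3 : a3 = (β * a8 * (a5 * a8 - a9 * a10) - γ * a9 * (2 * a4 * a7 - a8 * a10))
      / (2 * γ * (a6 * a10 - 2 * a4 * a5)))
    (U : Set (Fin 4 → ℂ)) (hU : IsOpen U)
    (u : (Fin 4 → ℂ) → ℂ) (hu : ContDiffOn ℂ 2 u U)
    (hne : ∀ z ∈ U, u z ≠ 0)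
    (hsol : ∀ z ∈ U, u z ^ (2 * m) = Qpoly m a1 a2 a3 a4 a5 a6 a7 a8 a9 a10 C z) :
    ∀ z ∈ U,
      α * pd 0 (pd 1 u) z * pd 2 (pd 3 u) z
        + β * pd 0 (pd 2 u) z * pd 1 (pd 3 u) z
        + γ * pd 0 (pd 3 u) z * pd 1 (pd 2 u) z = 0 := by
  intro z hz
  have E1 := E1_id α β γ hαβγ hγ a1 a2 a3 a4 a5 a6 a7 a8 a9 a10 ha6 ha7 hd1 hd2 hd3 ha1 ha2 ha3
    (z 0 ^ m) (z 1 ^ m) (z 2 ^ m) (z 3 ^ m) _ _ _ _ rfl rfl rfl rfl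
  have E0 : α * a5 * a8 + β * a9 * a10 + γ * a6 * a7 = 0 := by
    rw [ha7]; field_simp; ring
  have F := fun i => (pd_u hU hu hsol i z hz).trans (pd_Q m a1 a2 a3 a4 a5 a6 a7 a8 a9 a10 C z i)
  have S := fun i j (hij : i ≠ j) => (pd_pd_u hU hu hsol i j z hz).trans
    ((pd_congr isOpen_univ (fun y _ => pd_Q m a1 a2 a3 a4 a5 a6 a7 a8 a9 a10 C y i) j z trivial).trans
      (pd_lf m _ i j hij z))
  have F0 := F 0
  have F1 := F 1
  have F2 := F 2
  have F3 := F 3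
  have S01 := S 1 0 (by decide)
  have S02 := S 2 0 (by decide)
  have S03 := S 3 0 (by decide)
  have S12 := S 2 1 (by decide)
  have S13 := S 3 1 (by decide)
  have S23 := S 3 2 (by decide)
  have hw : ((2 * m : ℕ) : ℂ) * u z ^ (2 * m - 1) ≠ 0 :=
    mul_ne_zero (by exact_mod_cast (by omega)) (pow_ne_zero _ (hne z hz))
  clear F S ha1 ha2 ha3 ha7 hsol hu
  simp [lf, -Nat.cast_mul, -mul_eq_mul_left_iff, -mul_eq_mul_right_iff] at F0 F1 F2 F3 S01 S02 S03 S12 S13 S23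
  generalize ((2 * m : ℕ) : ℂ) * u z ^ (2 * m - 1) = w at *
  generalize ((2 * m : ℕ) : ℂ) * ((2 * m - 1 : ℕ) : ℂ) * u z ^ (2 * m - 1 - 1) = v at *
  generalize 2 * a1 * z 0 ^ m + a5 * z 1 ^ m + a9 * z 2 ^ m + a6 * z 3 ^ m = l0 at *
  generalize a5 * z 0 ^ m + 2 * a2 * z 1 ^ m + a7 * z 2 ^ m + a10 * z 3 ^ m = l1 at *
  generalize a9 * z 0 ^ m + a7 * z 1 ^ m + 2 * a3 * z 2 ^ m + a8 * z 3 ^ m = l2 at *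
  generalize a6 * z 0 ^ m + a10 * z 1 ^ m + a8 * z 2 ^ m + 2 * a4 * z 3 ^ m = l3 at *
  generalize z 0 ^ (m - 1) = p0 at *
  generalize z 1 ^ (m - 1) = p1 at *
  generalize z 2 ^ (m - 1) = p2 at *
  generalize z 3 ^ (m - 1) = p3 at *
  generalize (m : ℂ) = M at *
  have key : ∀ (ui uj uij pi pj li lj h : ℂ), w * ui = M * pi * li → w * uj = M * pj * lj →
      v * uj * ui + w * uij = M ^ 2 * pi * pj * h →
      w ^ 3 * uij = M ^ 2 * pi * pj * (w ^ 2 * h - v * li * lj) := by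
    intro ui uj uij pi pj li lj h h1 h2 h3
    linear_combination w ^ 2 * h3 - v * w * uj * h1 - v * M * pi * li * h2
  have T01 := key _ _ _ _ _ _ _ _ F1 F0 S01
  have T02 := key _ _ _ _ _ _ _ _ F2 F0 S02
  have T03 := key _ _ _ _ _ _ _ _ F3 F0 S03
  have T12 := key _ _ _ _ _ _ _ _ F2 F1 S12
  have T13 := key _ _ _ _ _ _ _ _ F3 F1 S13
  have T23 := key _ _ _ _ _ _ _ _ F3 F2 S23
  refine (mul_eq_zero.mp (?_ : w ^ 6 * _ = 0)).resolve_left (pow_ne_zero _ hw)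
  calc _ = α * (w ^ 3 * pd 0 (pd 1 u) z) * (w ^ 3 * pd 2 (pd 3 u) z)
        + β * (w ^ 3 * pd 0 (pd 2 u) z) * (w ^ 3 * pd 1 (pd 3 u) z)
        + γ * (w ^ 3 * pd 0 (pd 3 u) z) * (w ^ 3 * pd 1 (pd 2 u) z) := by ring
    _ = 0 := by
      rw [T01, T02, T03, T12, T13, T23]
      linear_combination M ^ 4 * p0 * p1 * p2 * p3 *
        (w ^ 4 * E0 - w ^ 2 * v * E1 + v ^ 2 * l0 * l1 * l2 * l3 * hαβγ)
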